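/- Let φ ∈ Φ. For every ρ > ρ̄ := ν L_f (1−t*_φ) φ'₋(1) / (1−t̄_φ), the set of global optimal solutions of the penalty problem (Pρ) coincides with the set of global optimal solutions of the MPEC (M). -/

import Mathlib

open scoped BigOperators
open Classical

noncomputable section

/-- Convexity for extended-real-valued functions on `ℝ`. -/
def ERealConvexOn (φ : ℝ → EReal) : Prop :=
  ∀ x y t : ℝ, 0 ≤ t → t ≤ 1 →
    φ (t * x + (1 - t) * y) ≤ (t : EReal) * φ x + ((1 - t : ℝ) : EReal) * φ y

/-- The subdifferential of a convex function `φ : ℝ → EReal` at a point `t`. -/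
def subdiff (φ : ℝ → EReal) (t : ℝ) : Set ℝ :=
  {g : ℝ | ∀ s : ℝ, φ t + ((g * (s - t) : ℝ) : EReal) ≤ φ s}

/-- The left derivative `φ'₋(t)` of a convex function (the infimum of its subdifferential). -/
def leftDeriv (φ : ℝ → EReal) (t : ℝ) : ℝ := sInf (subdiff φ t)

/-- `φ` belongs to the family `Φ`, with distinguished unique minimizer `tstar` of `φ` on `[0,1]`:
`φ` is a lower semicontinuous proper convex function, `[0,1] ⊆ int(dom φ)`, `φ(1) = 1`,
and `φ(tstar) = 0`. -/
structure MemPhi (φ : ℝ → EReal) (tstar : ℝ) : Prop where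
  lsc : LowerSemicontinuous φ
  convex : ERealConvexOn φ
  proper : ∀ t, φ t ≠ ⊥
  domInt : Set.Icc (0:ℝ) 1 ⊆ interior {t | φ t ≠ ⊤}
  phiOne : φ 1 = 1
  tstarMem : tstar ∈ Set.Icc (0:ℝ) 1
  tstarMin : ∀ t ∈ Set.Icc (0:ℝ) 1, t ≠ tstar → φ tstar < φ t
  phiTstar : φ tstar = 0

/-- `tbar` is the minimal element of `[tstar, 1)` with `1/(1 - tstar) ∈ ∂φ(tbar)`. -/
def IsTbar (φ : ℝ → EReal) (tstar tbar : ℝ) : Prop :=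
  tbar ∈ Set.Ico tstar 1 ∧ (1 / (1 - tstar)) ∈ subdiff φ tbar ∧
    ∀ t ∈ Set.Ico tstar 1, (1 / (1 - tstar)) ∈ subdiff φ t → tbar ≤ t

/-- A partition of `{1,…,p}` into `m` nonempty groups. -/
structure GroupStructure (p m : ℕ) where
  J : Fin m → Finset (Fin p)
  nonem : ∀ i, (J i).Nonempty
  disj : ∀ i j, i ≠ j → Disjoint (J i) (J j)
  cover : ∀ k : Fin p, ∃ i, k ∈ J i

variable {p m n : ℕ}

/-- The Euclidean norm of the `i`-th block `x_{𝒥ᵢ}` of `x`. -/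
def gnorm (G : GroupStructure p m) (x : Fin p → ℝ) (i : Fin m) : ℝ :=
  Real.sqrt (∑ j ∈ G.J i, (x j) ^ 2)

/-- The Euclidean norm of a vector. -/
def enorm' {k : ℕ} (x : Fin k → ℝ) : ℝ := Real.sqrt (∑ j, (x j) ^ 2)

/-- The group support `{i : x_{𝒥ᵢ} ≠ 0}` of `x`. -/
def gsupp (G : GroupStructure p m) (x : Fin p → ℝ) : Finset (Fin m) :=
  Finset.univ.filter (fun i => ∃ j ∈ G.J i, x j ≠ 0)

/-- The group zero-norm `‖𝒢(x)‖₀` of `x`. -/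
def gzero (G : GroupStructure p m) (x : Fin p → ℝ) : ℕ := (gsupp G x).card

/-- `‖𝒢(x)‖_∞`, the largest block norm. -/
def gsup (G : GroupStructure p m) (x : Fin p → ℝ) : ℝ := ⨆ i, gnorm G x i

/-- The box `Ω = {x : ‖x‖_∞ ≤ R}`. -/
def OmegaSet (p : ℕ) (R : ℝ) : Set (Fin p → ℝ) := {x | ∀ j, |x j| ≤ R}

/-- The least-squares loss `f(x) = (1/(2n))‖Ax - b‖²`. -/
def lsObj (A : Matrix (Fin n) (Fin p) ℝ) (b : Fin n → ℝ) (x : Fin p → ℝ) : ℝ :=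
  (1 / (2 * n)) * ∑ i, (A.mulVec x i - b i) ^ 2

/-- The objective of the group zero-norm problem (P). -/
def Pobj (G : GroupStructure p m) (A : Matrix (Fin n) (Fin p) ℝ) (b : Fin n → ℝ)
    (ν : ℝ) (x : Fin p → ℝ) : ℝ :=
  ν * lsObj A b x + (gzero G x : ℝ)

/-- Feasibility for the MPEC (M). -/
def MFeas (G : GroupStructure p m) (R : ℝ) (x : Fin p → ℝ) (w : Fin m → ℝ) : Prop :=
  x ∈ OmegaSet p R ∧ (∀ i, 0 ≤ w i ∧ w i ≤ 1) ∧ ∑ i, (1 - w i) * gnorm G x i = 0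

/-- The objective of the MPEC (M). -/
def Mobj (G : GroupStructure p m) (A : Matrix (Fin n) (Fin p) ℝ) (b : Fin n → ℝ)
    (ν : ℝ) (φ : ℝ → EReal) (x : Fin p → ℝ) (w : Fin m → ℝ) : EReal :=
  ((ν * lsObj A b x : ℝ) : EReal) + ∑ i, φ (w i)

/-- The objective of the penalty problem (Pρ). -/
def PenObj (G : GroupStructure p m) (A : Matrix (Fin n) (Fin p) ℝ) (b : Fin n → ℝ)
    (ν ρ : ℝ) (φ : ℝ → EReal) (x : Fin p → ℝ) (w : Fin m → ℝ) : EReal :=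
  ((ν * lsObj A b x + ρ * ∑ i, (1 - w i) * gnorm G x i : ℝ) : EReal) + ∑ i, φ (w i)

/-- The cone `𝒞(S̄, l)` used in restricted strong convexity. -/
def coneC (G : GroupStructure p m) (tbar : ℝ) (Sb : Finset (Fin m)) (l : ℝ) :
    Set (Fin p → ℝ) :=
  {z | ∃ S : Finset (Fin m), Sb ⊆ S ∧ (S.card : ℝ) ≤ l ∧
    ∑ i ∈ Sᶜ, gnorm G z i ≤ (2 / (1 - tbar)) * ∑ i ∈ S, gnorm G z i}

/-- `ε̂ = (1/n) Aᵀ ε`. -/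
def epsHat (A : Matrix (Fin n) (Fin p) ℝ) (ε : Fin n → ℝ) : Fin p → ℝ :=
  fun j => (1 / (n : ℝ)) * ∑ i, A i j * ε i

/-- The group-wise truncation `x^ρ` of `x` at level `c` (blocks with norm `≤ c` are set to 0). -/
def trunc (G : GroupStructure p m) (c : ℝ) (x : Fin p → ℝ) : Fin p → ℝ :=
  fun j => if ∃ i : Fin m, j ∈ G.J i ∧ c < gnorm G x i then x j else 0

theorem coe_finset_sum_ereal {ι : Type*} (s : Finset ι) (f : ι → ℝ) :
    ((∑ i ∈ s, f i : ℝ) : EReal) = ∑ i ∈ s, (f i : EReal) := by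
  induction s using Finset.induction_on with
  | empty => simp
  | insert a s ha ih => rw [Finset.sum_insert ha, Finset.sum_insert ha, EReal.coe_add, ih]

namespace MemPhi

variable {φ : ℝ → EReal} {tstar : ℝ}

theorem ne_top (hφ : MemPhi φ tstar) {t : ℝ} (ht : t ∈ Set.Icc (0 : ℝ) 1) : φ t ≠ ⊤ :=
  interior_subset (hφ.domInt ht)

theorem coe_toReal (hφ : MemPhi φ tstar) {t : ℝ} (ht : t ∈ Set.Icc (0 : ℝ) 1) :
    ((φ t).toReal : EReal) = φ t :=
  EReal.coe_toReal (hφ.ne_top ht) (hφ.proper t)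

theorem toReal_one (hφ : MemPhi φ tstar) : (φ 1).toReal = 1 := by
  rw [hφ.phiOne]; rfl

theorem tstar_lt_one (hφ : MemPhi φ tstar) : tstar < 1 := by
  refine lt_of_le_of_ne hφ.tstarMem.2 fun h => ?_
  have h0 := hφ.phiTstar
  rw [h, hφ.phiOne] at h0
  exact one_ne_zero h0

theorem toReal_nonneg (hφ : MemPhi φ tstar) {t : ℝ} (ht : t ∈ Set.Icc (0 : ℝ) 1) :
    0 ≤ (φ t).toReal := by
  refine EReal.toReal_nonneg ?_
  rw [← hφ.phiTstar]
  by_cases h : t = tstar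
  · rw [h]
  · exact (hφ.tstarMin t ht h).le

theorem three_slopes (hφ : MemPhi φ tstar) {s u : ℝ} (hs : s < 1) (hu : 1 < u)
    (hs' : φ s ≠ ⊤) (hu' : φ u ≠ ⊤) :
    (1 - (φ s).toReal) / (1 - s) ≤ ((φ u).toReal - 1) / (u - 1) := by
  have hsu : 0 < u - s := by linarith
  have hc := hφ.convex s u ((u - 1) / (u - s)) (by apply div_nonneg <;> linarith)
    (by rw [div_le_one hsu]; linarith)
  have e : (u - 1) / (u - s) * s + (1 - (u - 1) / (u - s)) * u = 1 := by field_simp; ring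
  rw [e, hφ.phiOne, ← EReal.coe_toReal hs' (hφ.proper s),
    ← EReal.coe_toReal hu' (hφ.proper u)] at hc
  have hc' : (1 : ℝ) ≤ (u - 1) / (u - s) * (φ s).toReal
      + (1 - (u - 1) / (u - s)) * (φ u).toReal := by exact_mod_cast hc
  have e2 : (u - 1) / (u - s) * (φ s).toReal + (1 - (u - 1) / (u - s)) * (φ u).toReal
      = ((u - 1) * (φ s).toReal + (1 - s) * (φ u).toReal) / (u - s) := by field_simp; ring
  rw [e2, le_div_iff₀ hsu] at hc'
  rw [div_le_div_iff₀ (by linarith) (by linarith)]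
  nlinarith

theorem subdiff_one_nonempty (hφ : MemPhi φ tstar) : (subdiff φ 1).Nonempty := by
  obtain ⟨ε, hε, hball⟩ := Metric.isOpen_iff.1 isOpen_interior 1
    (hφ.domInt (Set.right_mem_Icc.2 zero_le_one))
  have hu₀ : φ (1 + ε / 2) ≠ ⊤ := interior_subset (hball (by
    rw [Metric.mem_ball, Real.dist_eq, add_sub_cancel_left, abs_of_pos (by linarith)]; linarith))
  set S : Set ℝ := {v | ∃ s, s < 1 ∧ φ s ≠ ⊤ ∧ v = (1 - (φ s).toReal) / (1 - s)} with hS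
  have hub : ∀ u, 1 < u → φ u ≠ ⊤ → ((φ u).toReal - 1) / (u - 1) ∈ upperBounds S := by
    rintro u hu hu' v ⟨s, hs, hs', rfl⟩
    exact hφ.three_slopes hs hu hs' hu'
  have hne : S.Nonempty := ⟨_, 0, zero_lt_one, hφ.ne_top (by simp), rfl⟩
  have hbdd : BddAbove S := ⟨_, hub _ (by linarith) hu₀⟩
  refine ⟨sSup S, fun s => ?_⟩
  by_cases hs : φ s = ⊤
  · rw [hs]; exact le_top
  rw [hφ.phiOne, ← EReal.coe_toReal hs (hφ.proper s)]
  suffices h : 1 + sSup S * (s - 1) ≤ (φ s).toReal by exact_mod_cast h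
  rcases lt_trichotomy s 1 with h | h | h
  · have := le_csSup hbdd ⟨s, h, hs, rfl⟩
    rw [div_le_iff₀ (by linarith)] at this
    linarith
  · rw [h, hφ.toReal_one]; simp
  · have := csSup_le hne (hub s h hs)
    rw [le_div_iff₀ (by linarith)] at this
    linarith

theorem one_sub_leftDeriv_mul_le (hφ : MemPhi φ tstar) {t : ℝ} (ht : t ∈ Set.Icc (0 : ℝ) 1) :
    1 - leftDeriv φ 1 * (1 - t) ≤ (φ t).toReal := by
  rcases ht.2.eq_or_lt with h | h
  · rw [h, hφ.toReal_one]; simp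
  have hle : (1 - (φ t).toReal) / (1 - t) ≤ leftDeriv φ 1 := by
    refine le_csInf hφ.subdiff_one_nonempty fun g hg => ?_
    have := hg t
    rw [hφ.phiOne, ← hφ.coe_toReal ht] at this
    have h' : 1 + g * (t - 1) ≤ (φ t).toReal := by exact_mod_cast this
    rw [div_le_iff₀ (by linarith)]
    linarith
  rw [div_le_iff₀ (by linarith)] at hle
  linarith

theorem one_le_leftDeriv_mul (hφ : MemPhi φ tstar) : 1 ≤ leftDeriv φ 1 * (1 - tstar) := by
  have := hφ.one_sub_leftDeriv_mul_le hφ.tstarMem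
  rw [hφ.phiTstar, EReal.toReal_zero] at this
  linarith

theorem leftDeriv_one_pos (hφ : MemPhi φ tstar) : 0 < leftDeriv φ 1 := by
  by_contra! h
  nlinarith [hφ.one_le_leftDeriv_mul, hφ.tstar_lt_one]

/-- The linear minorant of `φ` on `[0,1]` with slope `1 / (1 - tstar)` vanishing at `tbar`. -/
theorem sub_tbar_div_le (hφ : MemPhi φ tstar) {tbar : ℝ} (h : IsTbar φ tstar tbar) {t : ℝ}
    (ht : t ∈ Set.Icc (0 : ℝ) 1) : (t - tbar) / (1 - tstar) ≤ (φ t).toReal := by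
  have hb : tbar ∈ Set.Icc (0 : ℝ) 1 := ⟨hφ.tstarMem.1.trans h.1.1, h.1.2.le⟩
  have := h.2.1 t
  rw [← hφ.coe_toReal hb, ← hφ.coe_toReal ht] at this
  have h' : (φ tbar).toReal + 1 / (1 - tstar) * (t - tbar) ≤ (φ t).toReal := by
    exact_mod_cast this
  have h0 := hφ.toReal_nonneg hb
  rw [div_eq_inv_mul, ← one_div]
  linarith

/-- A group of small norm `g > 0` costs strictly more in the penalty problem than what setting it
to zero can cost in the loss. -/
theorem lt_add_penalty (hφ : MemPhi φ tstar) {tbar κ ρ g t : ℝ} (h : IsTbar φ tstar tbar)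
    (hκ : 0 ≤ κ) (hρ : κ * ((1 - tstar) * leftDeriv φ 1) / (1 - tbar) < ρ)
    (hg : 0 < g) (hgd : ρ * g ≤ leftDeriv φ 1) (ht : t ∈ Set.Icc (0 : ℝ) 1) :
    κ * g < (φ t).toReal + ρ * ((1 - t) * g) := by
  have h1 := hφ.one_le_leftDeriv_mul
  have hts := hφ.tstar_lt_one
  have hd := hφ.leftDeriv_one_pos
  have htb := h.1.2
  set d := leftDeriv φ 1
  have hρ' : κ * ((1 - tstar) * d) < ρ * (1 - tbar) := by
    rwa [div_lt_iff₀ (by linarith)] at hρ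
  have hρ0 : 0 < ρ := by
    refine lt_of_le_of_lt (div_nonneg (mul_nonneg hκ (mul_nonneg ?_ hd.le)) ?_) hρ <;> linarith
  have hbar : κ * g < ρ * g * (1 - tbar) := by
    have : κ ≤ κ * ((1 - tstar) * d) := le_mul_of_one_le_right hκ (by linarith)
    nlinarith
  rcases le_or_gt t tbar with htt | htt
  · have h0 := hφ.toReal_nonneg ht
    have : ρ * g * (1 - tbar) ≤ ρ * g * (1 - t) :=
      mul_le_mul_of_nonneg_left (by linarith) (by positivity)
    linarith
  · have hlin := hφ.sub_tbar_div_le h ht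
    have hone : κ * g * (1 - tstar) < 1 - tbar := by
      have e1 : κ * g * (1 - tstar) * d < (1 - tbar) * d := by
        calc κ * g * (1 - tstar) * d = κ * ((1 - tstar) * d) * g := by ring
          _ < ρ * (1 - tbar) * g := mul_lt_mul_of_pos_right hρ' hg
          _ = ρ * g * (1 - tbar) := by ring
          _ ≤ d * (1 - tbar) := mul_le_mul_of_nonneg_right hgd (by linarith)
          _ = _ := by ring
      exact lt_of_mul_lt_mul_right e1 hd.le
    have hts' : 0 < 1 - tstar := by linarith
    rw [div_le_iff₀ hts'] at hlin
    have key : κ * g * (1 - tstar) * (1 - tbar)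
        < ((φ t).toReal + ρ * ((1 - t) * g)) * (1 - tstar) * (1 - tbar) := by
      have a1 : κ * g * (1 - tstar) * (t - tbar) < (1 - tbar) * (t - tbar) :=
        mul_lt_mul_of_pos_right hone (by linarith)
      have a2 : κ * g * ((1 - t) * (1 - tstar)) ≤ ρ * g * (1 - tbar) * ((1 - t) * (1 - tstar)) :=
        mul_le_mul_of_nonneg_right hbar.le (mul_nonneg (by linarith [ht.2]) hts'.le)
      have a3 : (t - tbar) * (1 - tbar) ≤ (φ t).toReal * (1 - tstar) * (1 - tbar) :=
        mul_le_mul_of_nonneg_right hlin (by linarith)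
      linarith
    have := lt_of_mul_lt_mul_right key (by linarith)
    exact lt_of_mul_lt_mul_right this hts'.le

end MemPhi

theorem gnorm_nonneg (G : GroupStructure p m) (x : Fin p → ℝ) (i : Fin m) : 0 ≤ gnorm G x i :=
  Real.sqrt_nonneg _

theorem enorm'_le_sum_gnorm (G : GroupStructure p m) (z : Fin p → ℝ) :
    enorm' z ≤ ∑ i, gnorm G z i := by
  refine Real.sqrt_le_iff.2 ⟨Finset.sum_nonneg fun i _ => gnorm_nonneg G z i, ?_⟩
  have hU : (Finset.univ : Finset (Fin p)) = Finset.univ.biUnion G.J := by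
    ext k; simpa using G.cover k
  calc ∑ j, z j ^ 2 = ∑ i, ∑ j ∈ G.J i, z j ^ 2 := by
        rw [hU, Finset.sum_biUnion fun i _ j _ hij => G.disj i j hij]
    _ = ∑ i, gnorm G z i ^ 2 := Finset.sum_congr rfl fun i _ =>
        (Real.sq_sqrt (Finset.sum_nonneg fun j _ => sq_nonneg (z j))).symm
    _ ≤ (∑ i, gnorm G z i) ^ 2 :=
        Finset.sum_sq_le_sq_sum_of_nonneg fun i _ => gnorm_nonneg G z i

theorem gnorm_congr (G : GroupStructure p m) {x y : Fin p → ℝ} {i : Fin m}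
    (h : ∀ j ∈ G.J i, x j = y j) : gnorm G x i = gnorm G y i := by
  unfold gnorm
  rw [Finset.sum_congr rfl fun j hj => by rw [h j hj]]

theorem gnorm_zero (G : GroupStructure p m) (i : Fin m) : gnorm G 0 i = 0 := by
  simp [gnorm]

theorem trunc_apply (G : GroupStructure p m) (c : ℝ) (x : Fin p → ℝ) {i : Fin m} {j : Fin p}
    (hj : j ∈ G.J i) : trunc G c x j = if c < gnorm G x i then x j else 0 := by
  have : (∃ i' : Fin m, j ∈ G.J i' ∧ c < gnorm G x i') ↔ c < gnorm G x i := by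
    refine ⟨fun ⟨i', hj', hc⟩ => ?_, fun hc => ⟨i, hj, hc⟩⟩
    have : i' = i := by
      by_contra hne
      exact Finset.disjoint_left.1 (G.disj i' i hne) hj' hj
    rwa [← this]
  simp only [trunc, this]

theorem gnorm_trunc (G : GroupStructure p m) (c : ℝ) (x : Fin p → ℝ) (i : Fin m) :
    gnorm G (trunc G c x) i = if c < gnorm G x i then gnorm G x i else 0 := by
  split_ifs with h
  · exact gnorm_congr G fun j hj => by rw [trunc_apply G c x hj, if_pos h]
  · rw [← gnorm_zero G i]
    exact gnorm_congr G fun j hj => by rw [trunc_apply G c x hj, if_neg h, Pi.zero_apply]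

theorem gnorm_trunc_sub (G : GroupStructure p m) (c : ℝ) (x : Fin p → ℝ) (i : Fin m) :
    gnorm G (trunc G c x - x) i = if c < gnorm G x i then 0 else gnorm G x i := by
  split_ifs with h
  · rw [← gnorm_zero G i]
    exact gnorm_congr G fun j hj => by simp [trunc_apply G c x hj, h]
  · unfold gnorm at h ⊢
    congr 1
    refine Finset.sum_congr rfl fun j hj => ?_
    have := trunc_apply G c x hj
    unfold gnorm at this
    rw [if_neg h] at this
    simp [this]

theorem trunc_mem_OmegaSet (G : GroupStructure p m) (c : ℝ) {R : ℝ} (hR : 0 ≤ R)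
    {x : Fin p → ℝ} (hx : x ∈ OmegaSet p R) : trunc G c x ∈ OmegaSet p R := by
  intro j
  unfold trunc
  split_ifs
  · exact hx j
  · simpa using hR

theorem lipschitz_const_nonneg {A : Matrix (Fin n) (Fin p) ℝ} {b : Fin n → ℝ} {R Lf : ℝ}
    (hR : 0 < R) (hLf : ∀ x ∈ OmegaSet p R, ∀ y ∈ OmegaSet p R,
      |lsObj A b x - lsObj A b y| ≤ Lf * enorm' (x - y)) (j : Fin p) : 0 ≤ Lf := by
  have h := hLf (fun _ => R) (fun j => by simp [abs_of_pos hR]) 0 (fun j => by simpa using hR.le)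
  have hpos : 0 < enorm' ((fun _ => R : Fin p → ℝ) - 0) := by
    refine Real.sqrt_pos.2 (Finset.sum_pos (fun i _ => ?_) ⟨j, Finset.mem_univ j⟩)
    simpa using pow_pos hR 2
  exact nonneg_of_mul_nonneg_left ((abs_nonneg _).trans h) hpos

/-- The objective of the penalty problem as a real number, for `w ∈ [0,1]^m`. -/
def penReal (G : GroupStructure p m) (A : Matrix (Fin n) (Fin p) ℝ) (b : Fin n → ℝ)
    (ν ρ : ℝ) (φ : ℝ → EReal) (x : Fin p → ℝ) (w : Fin m → ℝ) : ℝ :=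
  ν * lsObj A b x + ρ * ∑ i, (1 - w i) * gnorm G x i + ∑ i, (φ (w i)).toReal

theorem PenObj_eq_coe {φ : ℝ → EReal} {tstar : ℝ} (hφ : MemPhi φ tstar)
    (G : GroupStructure p m) (A : Matrix (Fin n) (Fin p) ℝ) (b : Fin n → ℝ) (ν ρ : ℝ)
    (x : Fin p → ℝ) {w : Fin m → ℝ} (hw : ∀ i, 0 ≤ w i ∧ w i ≤ 1) :
    PenObj G A b ν ρ φ x w = (penReal G A b ν ρ φ x w : EReal) := by
  unfold PenObj penReal
  rw [EReal.coe_add _ (∑ i, (φ (w i)).toReal), coe_finset_sum_ereal]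
  simp only [fun i => hφ.coe_toReal (hw i)]

theorem MFeas.PenObj_eq_Mobj {G : GroupStructure p m} {R : ℝ} {x : Fin p → ℝ} {w : Fin m → ℝ}
    (h : MFeas G R x w) (A : Matrix (Fin n) (Fin p) ℝ) (b : Fin n → ℝ) (ν ρ : ℝ)
    (φ : ℝ → EReal) : PenObj G A b ν ρ φ x w = Mobj G A b ν φ x w := by
  unfold PenObj Mobj
  rw [h.2.2, mul_zero, add_zero]

/-- Every feasible point of the penalty problem is dominated by a feasible point of the MPEC,
strictly so when it is itself infeasible for the MPEC. -/
theorem exists_MFeas_penReal_le (G : GroupStructure p m) (A : Matrix (Fin n) (Fin p) ℝ)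
    (b : Fin n → ℝ) {ν R Lf : ℝ} (hν : 0 < ν) (hR : 0 < R)
    (hLf : ∀ x ∈ OmegaSet p R, ∀ y ∈ OmegaSet p R,
      |lsObj A b x - lsObj A b y| ≤ Lf * enorm' (x - y))
    {φ : ℝ → EReal} {tstar tbar : ℝ} (hφ : MemPhi φ tstar) (htbar : IsTbar φ tstar tbar)
    {ρ : ℝ} (hρ : ν * Lf * ((1 - tstar) * leftDeriv φ 1) / (1 - tbar) < ρ)
    {x : Fin p → ℝ} {w : Fin m → ℝ} (hx : x ∈ OmegaSet p R) (hw : ∀ i, 0 ≤ w i ∧ w i ≤ 1) :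
    ∃ y w', MFeas G R y w' ∧ penReal G A b ν ρ φ y w' ≤ penReal G A b ν ρ φ x w ∧
      (¬ MFeas G R x w → penReal G A b ν ρ φ y w' < penReal G A b ν ρ φ x w) := by
  rcases isEmpty_or_nonempty (Fin m) with hm | ⟨⟨i₀⟩⟩
  · have hxw : MFeas G R x w := ⟨hx, hw, by simp⟩
    exact ⟨x, w, hxw, le_rfl, fun h => (h hxw).elim⟩
  have hL : 0 ≤ Lf := lipschitz_const_nonneg hR hLf (G.nonem i₀).choose
  have hd := hφ.leftDeriv_one_pos
  have hρ0 : 0 < ρ := by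
    refine lt_of_le_of_lt (div_nonneg (mul_nonneg (mul_nonneg hν.le hL)
      (mul_nonneg ?_ hd.le)) ?_) hρ
    · linarith [hφ.tstar_lt_one]
    · linarith [htbar.1.2]
  set c := leftDeriv φ 1 / ρ with hc
  set y := trunc G c x with hy
  set w' : Fin m → ℝ := fun i =>
    if c < gnorm G x i then 1 else if gnorm G x i = 0 then w i else tstar with hw'
  have hw'I : ∀ i, 0 ≤ w' i ∧ w' i ≤ 1 := by
    intro i
    simp only [hw']
    split_ifs
    · simp
    · exact hw i
    · exact hφ.tstarMem
  have hyΩ : y ∈ OmegaSet p R := trunc_mem_OmegaSet G c hR.le hx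
  have hzero : ∑ i, (1 - w' i) * gnorm G y i = 0 := by
    refine Finset.sum_eq_zero fun i _ => ?_
    simp only [hw', hy, gnorm_trunc]
    split_ifs <;> simp
  have hloc : ∀ i, ν * Lf * gnorm G (y - x) i + (φ (w' i)).toReal
        ≤ (φ (w i)).toReal + ρ * ((1 - w i) * gnorm G x i) ∧
      ((1 - w i) * gnorm G x i ≠ 0 → ν * Lf * gnorm G (y - x) i + (φ (w' i)).toReal
        < (φ (w i)).toReal + ρ * ((1 - w i) * gnorm G x i)) := by
    intro i
    simp only [hw', hy, gnorm_trunc_sub]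
    have hg := gnorm_nonneg G x i
    split_ifs with h1 h2
    · rw [hφ.toReal_one]
      have hlow := hφ.one_sub_leftDeriv_mul_le (hw i)
      have hcg : leftDeriv φ 1 < ρ * gnorm G x i := by
        rw [hc, div_lt_iff₀ hρ0] at h1; linarith
      have h1w : 0 ≤ 1 - w i := by linarith [(hw i).2]
      refine ⟨by nlinarith, fun hne => ?_⟩
      have : 0 < 1 - w i := lt_of_le_of_ne h1w fun h => hne (by rw [← h, zero_mul])
      nlinarith
    · simp [h2]
    · have hcg : ρ * gnorm G x i ≤ leftDeriv φ 1 := by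
        rw [hc, not_lt, le_div_iff₀ hρ0] at h1; linarith
      have := hφ.lt_add_penalty htbar (mul_nonneg hν.le hL) hρ (lt_of_le_of_ne hg (Ne.symm h2))
        hcg (hw i)
      rw [hφ.phiTstar, EReal.toReal_zero, add_zero]
      exact ⟨this.le, fun _ => this⟩
  have hf : ν * lsObj A b y ≤ ν * lsObj A b x + ∑ i, ν * Lf * gnorm G (y - x) i := by
    have h1 := (le_abs_self _).trans (hLf y hyΩ x hx)
    have h2 := mul_le_mul_of_nonneg_left (enorm'_le_sum_gnorm G (y - x)) hL
    have h3 := mul_le_mul_of_nonneg_left (h1.trans h2) hν.le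
    rw [← Finset.mul_sum]
    linarith
  have hx' : penReal G A b ν ρ φ x w = ν * lsObj A b x
      + ∑ i, ((φ (w i)).toReal + ρ * ((1 - w i) * gnorm G x i)) := by
    rw [Finset.sum_add_distrib, ← Finset.mul_sum, penReal]; ring
  have hy' : penReal G A b ν ρ φ y w' ≤ ν * lsObj A b x
      + ∑ i, (ν * Lf * gnorm G (y - x) i + (φ (w' i)).toReal) := by
    rw [Finset.sum_add_distrib, penReal, hzero]; linarith
  refine ⟨y, w', ⟨hyΩ, hw'I, hzero⟩, ?_, fun hnot => ?_⟩
  · rw [hx']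
    exact hy'.trans (add_le_add_right (Finset.sum_le_sum fun i _ => (hloc i).1) _)
  · obtain ⟨i, -, hi⟩ : ∃ i ∈ Finset.univ, (1 - w i) * gnorm G x i ≠ 0 :=
      Finset.exists_ne_zero_of_sum_ne_zero fun h => hnot ⟨hx, hw, h⟩
    rw [hx']
    exact hy'.trans_lt (add_lt_add_right (Finset.sum_lt_sum (fun i _ => (hloc i).1)
      ⟨i, Finset.mem_univ i, (hloc i).2 hi⟩) _)

/-- **Theorem 2.1, global exact penalty.** For every
`ρ > ρ̄ = ν L_f (1-tstar) φ'₋(1) / (1-tbar)`, the global solution set of the penalty problem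
(Pρ) coincides with the global solution set of the MPEC (M). -/
theorem exact_penalty {p m n : ℕ} (G : GroupStructure p m) (A : Matrix (Fin n) (Fin p) ℝ)
    (b : Fin n → ℝ) (ν R Lf : ℝ) (hν : 0 < ν) (hR : 0 < R)
    (hLf : ∀ x ∈ OmegaSet p R, ∀ y ∈ OmegaSet p R,
      |lsObj A b x - lsObj A b y| ≤ Lf * enorm' (x - y))
    (φ : ℝ → EReal) (tstar tbar : ℝ) (hφ : MemPhi φ tstar) (htbar : IsTbar φ tstar tbar)
    (ρ : ℝ) (hρ : ν * Lf * ((1 - tstar) * leftDeriv φ 1) / (1 - tbar) < ρ) :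
    {xw : (Fin p → ℝ) × (Fin m → ℝ) |
        xw.1 ∈ OmegaSet p R ∧ (∀ i, 0 ≤ xw.2 i ∧ xw.2 i ≤ 1) ∧
        ∀ y w', y ∈ OmegaSet p R → (∀ i, 0 ≤ w' i ∧ w' i ≤ 1) →
          PenObj G A b ν ρ φ xw.1 xw.2 ≤ PenObj G A b ν ρ φ y w'} =
    {xw : (Fin p → ℝ) × (Fin m → ℝ) | MFeas G R xw.1 xw.2 ∧
        ∀ y w', MFeas G R y w' → Mobj G A b ν φ xw.1 xw.2 ≤ Mobj G A b ν φ y w'} := by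
  have dominate : ∀ x w, x ∈ OmegaSet p R → (∀ i, 0 ≤ w i ∧ w i ≤ 1) →
      ∃ y w', MFeas G R y w' ∧ PenObj G A b ν ρ φ y w' ≤ PenObj G A b ν ρ φ x w ∧
        (¬ MFeas G R x w → PenObj G A b ν ρ φ y w' < PenObj G A b ν ρ φ x w) := by
    intro x w hx hw
    obtain ⟨y, w', hF, hle, hlt⟩ :=
      exists_MFeas_penReal_le G A b hν hR hLf hφ htbar hρ hx hw
    refine ⟨y, w', hF, ?_⟩
    rw [PenObj_eq_coe hφ G A b ν ρ y hF.2.1, PenObj_eq_coe hφ G A b ν ρ x hw]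
    exact ⟨EReal.coe_le_coe_iff.2 hle, fun h => EReal.coe_lt_coe_iff.2 (hlt h)⟩
  ext ⟨x, w⟩
  constructor
  · rintro ⟨hx, hw, hopt⟩
    have hF : MFeas G R x w := by
      by_contra hnot
      obtain ⟨y, w', hF, -, hlt⟩ := dominate x w hx hw
      exact (hlt hnot).not_ge (hopt y w' hF.1 hF.2.1)
    refine ⟨hF, fun y w' hF' => ?_⟩
    rw [← hF.PenObj_eq_Mobj A b ν ρ φ, ← hF'.PenObj_eq_Mobj A b ν ρ φ]
    exact hopt y w' hF'.1 hF'.2.1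
  · rintro ⟨hF, hopt⟩
    refine ⟨hF.1, hF.2.1, fun y w' hy hw' => ?_⟩
    obtain ⟨z, u, hF', hle, -⟩ := dominate y w' hy hw'
    refine le_trans ?_ hle
    rw [hF.PenObj_eq_Mobj A b ν ρ φ, hF'.PenObj_eq_Mobj A b ν ρ φ]
    exact hopt z u hF'

end
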